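/- arXiv:1908.02438 — 2 statements merged into one kernel-verified Lean document; each statement's English description precedes it below -/
import Mathlib

section
/- Let k be a field of characteristic p > 0, let B = k[x]/(x^{p^n}) for some n ≥ 0, and let A ⊆ B be a k-subalgebra such that B is flat (equivalently free) as an A-module. Then A is isomorphic as a k-algebra to k[y]/(y^{p^m}) for some m ≤ n; in particular the cotangent space m_A/m_A² of A has k-dimension at most 1. -/
open Polynomial

set_option synthInstance.maxHeartbeats 400000

/-- A `k`-algebra with a nilpotent principal augmentation ideal is a truncated polynomial
algebra. -/
theorem exists_algEquiv_of_ker_eq_span_nilpotent {k A : Type*} [Field k] [CommRing A]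
    [Algebra k A] (ε : A →ₐ[k] k) (a : A) (ha : RingHom.ker ε = Ideal.span {a})
    (hnil : IsNilpotent a) :
    ∃ s : ℕ, Nonempty (A ≃ₐ[k] k[X] ⧸ Ideal.span {(X : k[X]) ^ s}) := by
  obtain ⟨N, hN⟩ := hnil
  have approx : ∀ (j : ℕ) (z : A), ∃ q : k[X], a ^ j ∣ z - aeval a q := by
    intro j
    induction j with
    | zero => exact fun z => ⟨0, by simp⟩
    | succ j ih =>
      intro z
      have hz : z - algebraMap k A (ε z) ∈ RingHom.ker ε := by simp [RingHom.mem_ker]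
      rw [ha, Ideal.mem_span_singleton] at hz
      obtain ⟨w, hw⟩ := hz
      obtain ⟨q, u, hu⟩ := ih w
      refine ⟨C (ε z) + X * q, u, ?_⟩
      simp only [map_add, map_mul, aeval_C, aeval_X]
      linear_combination hw + a * hu
  have hsurj : Function.Surjective (aeval (R := k) a) := by
    intro z
    obtain ⟨q, hq⟩ := approx N z
    rw [hN, zero_dvd_iff, sub_eq_zero] at hq
    exact ⟨q, hq.symm⟩
  obtain ⟨g, hg⟩ := (IsPrincipalIdealRing.principal (RingHom.ker (aeval (R := k) a))).principal
  have hgX : g ∣ X ^ N := by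
    rw [← Ideal.mem_span_singleton]
    change X ^ N ∈ Submodule.span k[X] {g}
    rw [← hg, RingHom.mem_ker, map_pow, aeval_X, hN]
  obtain ⟨s, -, hs⟩ := (dvd_prime_pow prime_X N).1 hgX
  have hker : RingHom.ker (aeval (R := k) a) = Ideal.span {(X : k[X]) ^ s} :=
    hg.trans (Ideal.span_singleton_eq_span_singleton.2 hs)
  exact ⟨s, ⟨(Ideal.quotientKerAlgEquivOfSurjective hsurj).symm.trans
    (Ideal.quotientEquivAlgOfEq k hker)⟩⟩

/-- Divisibility is total in a truncated polynomial algebra. -/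
theorem dvd_total_quotient_span_X_pow {k : Type*} [Field k] (N : ℕ)
    (b c : k[X] ⧸ Ideal.span {(X : k[X]) ^ N}) : b ∣ c ∨ c ∣ b := by
  have key : ∀ b : k[X] ⧸ Ideal.span {(X : k[X]) ^ N},
      ∃ i : ℕ, Associated (Ideal.Quotient.mk (Ideal.span {(X : k[X]) ^ N}) X ^ i) b := by
    intro b
    obtain ⟨f, rfl⟩ := Ideal.Quotient.mk_surjective b
    by_cases hf : f = 0
    · refine ⟨N, ?_⟩
      rw [hf, map_zero, ← map_pow, Ideal.Quotient.eq_zero_iff_mem.2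
        (Ideal.mem_span_singleton_self _)]
    · obtain ⟨g, hfg, hg⟩ :=
        (FiniteMultiplicity.of_prime_left prime_X hf).exists_eq_pow_mul_and_not_dvd
      obtain ⟨u, v, huv⟩ := (((irreducible_X (R := k)).coprime_iff_not_dvd).2 hg).pow_left (m := N)
      have hunit : IsUnit (Ideal.Quotient.mk (Ideal.span {(X : k[X]) ^ N}) g) := by
        refine IsUnit.of_mul_eq_one_right (Ideal.Quotient.mk _ v) ?_
        rw [← map_mul, ← map_one (Ideal.Quotient.mk _), Ideal.Quotient.eq,
          Ideal.mem_span_singleton]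
        exact ⟨-u, by linear_combination huv⟩
      refine ⟨multiplicity X f, ?_⟩
      nth_rewrite 2 [hfg]
      rw [map_mul, map_pow]
      exact associated_mul_unit_right _ _ hunit
  obtain ⟨i, hi⟩ := key b
  obtain ⟨j, hj⟩ := key c
  rw [← hi.dvd_iff_dvd_left, ← hj.dvd_iff_dvd_right, ← hj.dvd_iff_dvd_left,
    ← hi.dvd_iff_dvd_right]
  exact (le_total i j).imp (pow_dvd_pow _) (pow_dvd_pow _)

/-- In a Noetherian ring with total divisibility, the extension of an ideal is generated by the
image of one of its elements. -/
theorem exists_map_eq_span_of_dvd_total {A B : Type*} [CommRing A] [CommRing B]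
    [IsNoetherianRing B] (f : A →+* B) (hB : ∀ b c : B, b ∣ c ∨ c ∣ b) (I : Ideal A) :
    ∃ a ∈ I, I.map f = Ideal.span {f a} := by
  obtain ⟨_, ⟨a, ha, rfl⟩, hmax⟩ := set_has_maximal_iff_noetherian.2 ‹IsNoetherianRing B›
    ((fun a => Ideal.span {f a}) '' (I : Set A)) ⟨_, 0, I.zero_mem, rfl⟩
  refine ⟨a, ha, le_antisymm ?_ ?_⟩
  · rw [Ideal.map_le_iff_le_comap]
    intro c hc
    rw [Ideal.mem_comap, Ideal.mem_span_singleton]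
    refine (hB (f a) (f c)).elim id fun h => ?_
    have hle : Ideal.span {f a} ≤ Ideal.span {f c} := Ideal.span_singleton_le_span_singleton.2 h
    have := hle.eq_of_not_lt (hmax _ ⟨c, hc, rfl⟩)
    exact Ideal.span_singleton_le_span_singleton.1 this.ge
  · rw [Ideal.span_singleton_le_iff_mem]
    exact Ideal.mem_map_of_mem f ha

/-- An augmented algebra with nil augmentation ideal over a field is local. -/
theorem isLocalRing_of_ker_nil {k A : Type*} [Field k] [CommRing A]
    [Algebra k A] (ε : A →ₐ[k] k) (hnil : ∀ a, ε a = 0 → IsNilpotent a) : IsLocalRing A := by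
  have : Nontrivial A := ε.toRingHom.domain_nontrivial
  have unit : ∀ a, ε a ≠ 0 → IsUnit a := by
    intro a ha
    have h := hnil (a - algebraMap k A (ε a)) (by simp)
    simpa using h.isUnit_add_left_of_commute ((IsUnit.mk0 _ ha).map (algebraMap k A))
      (Commute.all _ _)
  refine .of_isUnit_or_isUnit_one_sub_self fun a => ?_
  by_cases ha : ε a = 0
  · exact .inr (unit _ (by simp [ha]))
  · exact .inl (unit a ha)

/-- Let `k` be a field of characteristic `p > 0`, `B = k[x]/(x^{p^n})`, and
`A ⊆ B` a `k`-subalgebra such that `B` is flat as an `A`-module.  Then `A ≅ k[y]/(y^{p^m})`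
as a `k`-algebra for some `m ≤ n`. -/
theorem stmt3 (k : Type*) [Field k] (p : ℕ) [Fact p.Prime] [CharP k p] (n : ℕ)
    (A : Subalgebra k (Polynomial k ⧸ Ideal.span {(X : Polynomial k) ^ p ^ n}))
    (hflat : Module.Flat A (Polynomial k ⧸ Ideal.span {(X : Polynomial k) ^ p ^ n})) :
    ∃ m : ℕ, m ≤ n ∧
      Nonempty (A ≃ₐ[k] Polynomial k ⧸ Ideal.span {(X : Polynomial k) ^ p ^ m}) := by
  have hp : p.Prime := Fact.out
  have hN : p ^ n ≠ 0 := pow_ne_zero _ hp.ne_zero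
  have finrank_eq : ∀ s : ℕ, Module.finrank k (k[X] ⧸ Ideal.span {(X : k[X]) ^ s}) = s := by
    intro s
    rw [finrank_quotient_span_eq_natDegree, natDegree_X_pow]
  have : Module.Finite k (k[X] ⧸ Ideal.span {(X : k[X]) ^ p ^ n}) :=
    Module.finite_of_finrank_pos (by rw [finrank_eq]; positivity)
  let ε : (k[X] ⧸ Ideal.span {(X : k[X]) ^ p ^ n}) →ₐ[k] k :=
    Ideal.Quotient.liftₐ _ (aeval (0 : k)) fun f hf => by
      obtain ⟨g, rfl⟩ := Ideal.mem_span_singleton.1 hf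
      rw [map_mul, map_pow, aeval_X, zero_pow hN, zero_mul]
  have hnil : ∀ b, ε b = 0 → IsNilpotent b := by
    intro b hb
    obtain ⟨f, rfl⟩ := Ideal.Quotient.mk_surjective b
    replace hb : aeval (0 : k) f = 0 := hb
    obtain ⟨g, rfl⟩ := X_dvd_iff.2 ((coeff_zero_eq_aeval_zero f).trans hb)
    refine ⟨p ^ n, ?_⟩
    rw [← map_pow, mul_pow, Ideal.Quotient.eq_zero_iff_mem]
    exact Ideal.mul_mem_right _ _ (Ideal.mem_span_singleton_self _)
  have hnilA : ∀ a : A, ε.comp A.val a = 0 → IsNilpotent a := fun a ha =>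
    (IsNilpotent.map_iff (f := A.val) Subtype.val_injective).1 (hnil a ha)
  have : IsLocalRing A := isLocalRing_of_ker_nil (ε.comp A.val) hnilA
  have : Nontrivial (k[X] ⧸ Ideal.span {(X : k[X]) ^ p ^ n}) := ε.toRingHom.domain_nontrivial
  have : Module.Finite A (k[X] ⧸ Ideal.span {(X : k[X]) ^ p ^ n}) :=
    Module.Finite.of_restrictScalars_finite k A _
  have : Module.Free A (k[X] ⧸ Ideal.span {(X : k[X]) ^ p ^ n}) :=
    Module.free_of_flat_of_isLocalRing
  have : Module.FaithfullyFlat A (k[X] ⧸ Ideal.span {(X : k[X]) ^ p ^ n}) := inferInstance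
  obtain ⟨a, ha, hmap⟩ := exists_map_eq_span_of_dvd_total
    (algebraMap A (k[X] ⧸ Ideal.span {(X : k[X]) ^ p ^ n}))
    (dvd_total_quotient_span_X_pow _) (RingHom.ker (ε.comp A.val))
  have hspan : Ideal.span {algebraMap A (k[X] ⧸ Ideal.span {(X : k[X]) ^ p ^ n}) a} =
      (Ideal.span {a}).map (algebraMap A _) := by
    rw [Ideal.map_span, Set.image_singleton]
  have hker : RingHom.ker (ε.comp A.val) = Ideal.span {a} := by
    rw [← Ideal.comap_map_eq_self_of_faithfullyFlat
      (B := k[X] ⧸ Ideal.span {(X : k[X]) ^ p ^ n}) (RingHom.ker (ε.comp A.val)), hmap,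
      hspan,
      Ideal.comap_map_eq_self_of_faithfullyFlat]
  obtain ⟨s, ⟨e⟩⟩ := exists_algEquiv_of_ker_eq_span_nilpotent _ a hker (hnilA a ha)
  have hdvd : s ∣ p ^ n := by
    have h := Module.finrank_mul_finrank k A (k[X] ⧸ Ideal.span {(X : k[X]) ^ p ^ n})
    rw [e.toLinearEquiv.finrank_eq, finrank_eq, finrank_eq] at h
    exact ⟨_, h.symm⟩
  obtain ⟨m, hm, rfl⟩ := (Nat.dvd_prime_pow hp).1 hdvd
  exact ⟨m, hm, ⟨e⟩⟩
end

section
/- Let k be a field and G a nontrivial finite group scheme over k. Then the essential dimension of G over k is at least 1; equivalently, there exists a field extension K/k and a G-torsor over Spec(K) that is not defined over (does not descend to) any algebraic extension of k contained in K of transcendence degree 0. -/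
open TensorProduct

set_option synthInstance.maxHeartbeats 1000000
set_option maxHeartbeats 1000000

variable (k : Type) [Field k] (A : Type) [CommRing A] [HopfAlgebra k A]

/-- A torsor over `Spec K` under the affine group scheme `G = Spec A`: a nonzero finite
`K`-algebra `T` with a coaction `ρ` of `A` which is coassociative and counital and such
that the canonical map `T ⊗_K T → T ⊗_k A` is bijective. -/
structure GTorsor (K T : Type) [Field K] [Algebra k K] [CommRing T] [Algebra k T]
    [Algebra K T] [IsScalarTower k K T] where
  ρ : T →ₐ[K] T ⊗[k] A
  counital : (TensorProduct.rid k T).toLinearMap ∘ₗ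
      (LinearMap.lTensor T (Coalgebra.counit (R := k) (A := A))) ∘ₗ
        (ρ.toLinearMap.restrictScalars k) = LinearMap.id
  coassoc : (LinearMap.rTensor A (ρ.toLinearMap.restrictScalars k)) ∘ₗ
      (ρ.toLinearMap.restrictScalars k) =
      (TensorProduct.assoc k T A A).symm.toLinearMap ∘ₗ
        (LinearMap.lTensor T (Coalgebra.comul (R := k) (A := A))) ∘ₗ
          (ρ.toLinearMap.restrictScalars k)
  nontrivial : Nontrivial T
  finite : Module.Finite K T
  torsor : Function.Bijective
    (Algebra.TensorProduct.productMap
      (Algebra.TensorProduct.includeLeft : T →ₐ[K] T ⊗[k] A) ρ)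

section
variable {k A}
variable {B : Type} [CommRing B] [Algebra k B]

/-- The algebra map `x ⊗ y ↦ ∑ x S(y₁) ⊗ y₂` on `A ⊗ A`, where `S` is the antipode. -/
noncomputable def antipodeMul : A ⊗[k] A →ₐ[k] A ⊗[k] A :=
  Algebra.TensorProduct.productMap Algebra.TensorProduct.includeLeft
    ((Algebra.TensorProduct.map (HopfAlgebra.antipodeAlgHom k A) (AlgHom.id k A)).comp
      (Bialgebra.comulAlgHom k A))

theorem antipodeMul_comul (a : A) :
    antipodeMul (k := k) (Coalgebra.comul (R := k) a) = 1 ⊗ₜ a := by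
  have h1 : ∀ t : A ⊗[k] A, antipodeMul (k := k) t =
      (LinearMap.rTensor A (LinearMap.mul' k A ∘ₗ LinearMap.lTensor A (HopfAlgebra.antipode k)))
        ((TensorProduct.assoc k A A A).symm (LinearMap.lTensor A Coalgebra.comul t)) := by
    intro t
    induction t with
    | zero => simp
    | add x y hx hy => simp only [map_add, hx, hy]
    | tmul x y =>
      simp only [antipodeMul, Algebra.TensorProduct.productMap_apply_tmul, AlgHom.comp_apply,
        Bialgebra.comulAlgHom_apply, LinearMap.lTensor_tmul]
      generalize (Coalgebra.comul (R := k) y) = u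
      induction u with
      | zero => simp
      | add x y hx hy => simp only [map_add, tmul_add, mul_add, hx, hy]
      | tmul c d => simp
  have h2 : ∀ t : A ⊗[k] A, (LinearMap.rTensor A (LinearMap.mul' k A ∘ₗ
      LinearMap.lTensor A (HopfAlgebra.antipode k))) (LinearMap.rTensor A Coalgebra.comul t) =
      LinearMap.rTensor A (Algebra.linearMap k A) (LinearMap.rTensor A Coalgebra.counit t) := by
    intro t
    simp only [← LinearMap.rTensor_comp_apply, LinearMap.comp_assoc,
      HopfAlgebra.mul_antipode_lTensor_comul]
  rw [h1, Coalgebra.coassoc_symm_apply, h2, Coalgebra.rTensor_counit_comul]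
  simp

/-- For a coaction `ρ` and a functional `f` on `A`, the rule `l • ρ m ↦ (∑ f(l₁) l₀) • ρ m`
extends to a linear endomorphism of `B ⊗ A`. -/
theorem exists_linearMap_smul_coaction (ρ : B →ₐ[k] B ⊗[k] A)
    (hco : ∀ b, Algebra.TensorProduct.map ρ (AlgHom.id k A) (ρ b) =
      (TensorProduct.assoc k B A A).symm (LinearMap.lTensor B Coalgebra.comul (ρ b)))
    (f : A →ₗ[k] k) :
    ∃ E : B ⊗[k] A →ₗ[k] B ⊗[k] A, ∀ l m : B, E (l • ρ m) =
      (TensorProduct.rid k B (LinearMap.lTensor B f (ρ l))) • ρ m := by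
  let Θ : (B ⊗[k] A) ⊗[k] A →ₐ[k] (B ⊗[k] A) ⊗[k] A :=
    Algebra.TensorProduct.productMap Algebra.TensorProduct.includeLeft
      ((Algebra.TensorProduct.map Algebra.TensorProduct.includeRight (AlgHom.id k A)).comp
        ((Algebra.TensorProduct.map (HopfAlgebra.antipodeAlgHom k A) (AlgHom.id k A)).comp
          (Bialgebra.comulAlgHom k A)))
  let c : (B ⊗[k] A) ⊗[k] A →ₗ[k] B ⊗[k] A :=
    LinearMap.rTensor A ((TensorProduct.rid k B).toLinearMap ∘ₗ LinearMap.lTensor B f)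
  have hΘ : ∀ y : B ⊗[k] A,
      Θ ((TensorProduct.assoc k B A A).symm (LinearMap.lTensor B Coalgebra.comul y)) =
        LinearMap.rTensor A (Algebra.TensorProduct.includeLeft (R := k) (S := k) (A := B)
          (B := A)).toLinearMap y := by
    intro y
    have h : ∀ (x : B) (t : A ⊗[k] A), Θ ((TensorProduct.assoc k B A A).symm (x ⊗ₜ t)) =
        (TensorProduct.assoc k B A A).symm (x ⊗ₜ antipodeMul (k := k) t) := by
      intro x t
      induction t with
      | zero => simp
      | add x y hx hy => simp only [map_add, tmul_add, hx, hy]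
      | tmul c d =>
        simp only [Θ, antipodeMul, Algebra.TensorProduct.productMap_apply_tmul, AlgHom.comp_apply,
          TensorProduct.assoc_symm_tmul]
        generalize (Bialgebra.comulAlgHom k A) d = u
        induction u with
        | zero => simp
        | add x y hx hy => simp only [map_add, tmul_add, mul_add, hx, hy]
        | tmul c d => simp
    induction y with
    | zero => simp
    | add x y hx hy => simp only [map_add, hx, hy]
    | tmul x a => simp [h, antipodeMul_comul]
  refine ⟨c ∘ₗ Θ.toLinearMap ∘ₗ (Algebra.TensorProduct.map ρ (AlgHom.id k A)).toLinearMap, ?_⟩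
  intro l m
  have h1 : l • ρ m = (l ⊗ₜ 1) * ρ m := by
    rw [Algebra.smul_def]; rfl
  simp only [LinearMap.comp_apply, AlgHom.toLinearMap_apply, h1, map_mul, hco, hΘ]
  have h2 : Θ (Algebra.TensorProduct.map ρ (AlgHom.id k A) (l ⊗ₜ 1)) = ρ l ⊗ₜ 1 := by
    simp [Θ]
  rw [h2]
  generalize ρ l = u
  generalize ρ m = v
  induction u with
  | zero => simp
  | add x y hx hy => simp only [map_add, add_tmul, add_mul, add_smul, hx, hy]
  | tmul x a =>
    induction v with
    | zero => simp
    | add x y hx hy => simp only [map_add, mul_add, smul_add, hx, hy]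
    | tmul y b => simp [c, TensorProduct.smul_tmul']

theorem coaction_mem_nonZeroDivisors [IsDomain B] (ρ : B →ₐ[k] B ⊗[k] A)
    (hco : ∀ b, Algebra.TensorProduct.map ρ (AlgHom.id k A) (ρ b) =
      (TensorProduct.assoc k B A A).symm (LinearMap.lTensor B Coalgebra.comul (ρ b)))
    (hcu : ∀ b, TensorProduct.rid k B (LinearMap.lTensor B Coalgebra.counit (ρ b)) = b)
    {s : B} (hs : s ≠ 0) : ρ s ∈ nonZeroDivisors (B ⊗[k] A) := by
  let σ : B ⊗[k] A →ₐ[k] B ⊗[k] A :=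
    Algebra.TensorProduct.map (AlgHom.id k B) (HopfAlgebra.antipodeAlgHom k A)
  let Λ : (B ⊗[k] A) ⊗[k] A →ₐ[k] B ⊗[k] A :=
    Algebra.TensorProduct.productMap σ Algebra.TensorProduct.includeRight
  let Λ' : (B ⊗[k] A) ⊗[k] A →ₐ[k] B ⊗[k] A :=
    Algebra.TensorProduct.productMap (AlgHom.id k _)
      (Algebra.TensorProduct.includeRight.comp (HopfAlgebra.antipodeAlgHom k A))
  have hΛ : ∀ y : B ⊗[k] A,
      Λ ((TensorProduct.assoc k B A A).symm (LinearMap.lTensor B Coalgebra.comul y)) =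
        TensorProduct.rid k B (LinearMap.lTensor B Coalgebra.counit y) ⊗ₜ 1 := by
    intro y
    have h : ∀ (x : B) (t : A ⊗[k] A), Λ ((TensorProduct.assoc k B A A).symm (x ⊗ₜ t)) =
        x ⊗ₜ LinearMap.mul' k A (LinearMap.rTensor A (HopfAlgebra.antipode k) t) := by
      intro x t
      induction t with
      | zero => simp
      | add x y hx hy => simp only [map_add, tmul_add, hx, hy]
      | tmul c d => simp [Λ, σ]
    induction y with
    | zero => simp
    | add x y hx hy => simp only [map_add, add_tmul, hx, hy]
    | tmul x a =>
      rw [LinearMap.lTensor_tmul, h, HopfAlgebra.mul_antipode_rTensor_comul_apply]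
      simp [TensorProduct.smul_tmul, Algebra.algebraMap_eq_smul_one]
  have hΛ' : ∀ y : B ⊗[k] A,
      Λ' ((TensorProduct.assoc k B A A).symm (LinearMap.lTensor B Coalgebra.comul y)) =
        TensorProduct.rid k B (LinearMap.lTensor B Coalgebra.counit y) ⊗ₜ 1 := by
    intro y
    have h : ∀ (x : B) (t : A ⊗[k] A), Λ' ((TensorProduct.assoc k B A A).symm (x ⊗ₜ t)) =
        x ⊗ₜ LinearMap.mul' k A (LinearMap.lTensor A (HopfAlgebra.antipode k) t) := by
      intro x t
      induction t with
      | zero => simp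
      | add x y hx hy => simp only [map_add, tmul_add, hx, hy]
      | tmul c d => simp [Λ']
    induction y with
    | zero => simp
    | add x y hx hy => simp only [map_add, add_tmul, hx, hy]
    | tmul x a =>
      rw [LinearMap.lTensor_tmul, h, HopfAlgebra.mul_antipode_lTensor_comul_apply]
      simp [TensorProduct.smul_tmul, Algebra.algebraMap_eq_smul_one]
  let ψ := Λ.comp (Algebra.TensorProduct.map ρ (AlgHom.id k A))
  let φ : B ⊗[k] A →ₐ[k] B ⊗[k] A :=
    Algebra.TensorProduct.productMap ρ Algebra.TensorProduct.includeRight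
  have hψ : ∀ b, ψ (ρ b) = b ⊗ₜ 1 := by
    intro b
    rw [AlgHom.comp_apply, hco, hΛ, hcu]
  have hφσ : ∀ y, φ (σ y) = Λ' (Algebra.TensorProduct.map ρ (AlgHom.id k A) y) := by
    intro y
    induction y with
    | zero => simp
    | add x y hx hy => simp only [map_add, hx, hy]
    | tmul x a => simp [φ, σ, Λ']
  have hφψ : ∀ y, φ (ψ y) = y := by
    intro y
    induction y with
    | zero => simp
    | add x y hx hy => simp only [map_add, hx, hy]
    | tmul x a =>
      have h : ψ (x ⊗ₜ a) = σ (ρ x) * 1 ⊗ₜ a := by simp [ψ, Λ]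
      rw [h, map_mul, hφσ, hco, hΛ', hcu]
      simp [φ]
  rw [mem_nonZeroDivisors_iff_right]
  intro y hy
  have h : s • ψ y = 0 := by
    have := congrArg ψ hy
    rw [map_mul, hψ, map_zero, mul_comm] at this
    rw [Algebra.smul_def]
    exact this
  have h' := (smul_eq_zero.mp h).resolve_left hs
  rw [← hφψ y, h', map_zero]

/-- The subfield of coinvariants of a coaction of `A` on the field `L`. -/
def coinvariants {L : Type} [Field L] [Algebra k L] (ρ : L →ₐ[k] L ⊗[k] A) :
    IntermediateField k L where
  toSubalgebra := AlgHom.equalizer ρ Algebra.TensorProduct.includeLeft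
  inv_mem' x hx := by
    change ρ x = x ⊗ₜ 1 at hx
    change ρ x⁻¹ = x⁻¹ ⊗ₜ 1
    by_cases h : x = 0
    · simp [h]
    · have h1 : ρ x⁻¹ * ρ x = 1 := by rw [← map_mul, inv_mul_cancel₀ h, map_one]
      have h2 : (x⁻¹ ⊗ₜ[k] (1 : A)) * ρ x = 1 := by
        rw [hx, Algebra.TensorProduct.tmul_mul_tmul, inv_mul_cancel₀ h, one_mul]; rfl
      have h3 : ρ x * ρ x⁻¹ = 1 := by rw [mul_comm, h1]
      calc ρ x⁻¹ = (x⁻¹ ⊗ₜ[k] (1 : A) * ρ x) * ρ x⁻¹ := by rw [h2, one_mul]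
        _ = _ := by rw [mul_assoc, h3, mul_one]

theorem mem_coinvariants {L : Type} [Field L] [Algebra k L] {ρ : L →ₐ[k] L ⊗[k] A} {x : L} :
    x ∈ coinvariants ρ ↔ ρ x = x ⊗ₜ 1 := Iff.rfl

/-- A coaction carries families independent over the coinvariants to families in `L ⊗ A`
independent over `L`. -/
theorem linearIndependent_coaction {L : Type} [Field L] [Algebra k L] (ρ : L →ₐ[k] L ⊗[k] A)
    (hco : ∀ b, Algebra.TensorProduct.map ρ (AlgHom.id k A) (ρ b) =
      (TensorProduct.assoc k L A A).symm (LinearMap.lTensor L Coalgebra.comul (ρ b)))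
    (hcu : ∀ b, TensorProduct.rid k L (LinearMap.lTensor L Coalgebra.counit (ρ b)) = b)
    {ι : Type} (v : ι → L) (hv : LinearIndependent (coinvariants ρ) v) :
    LinearIndependent L (fun i => ρ (v i)) := by
  classical
  rw [linearIndependent_iff']
  intro s
  induction s using Finset.induction_on with
  | empty => simp
  | insert a s ha ih =>
    intro l hl
    rw [Finset.sum_insert ha] at hl
    by_cases h0 : l a = 0
    · rw [h0, zero_smul, zero_add] at hl
      intro i hi
      rcases Finset.mem_insert.mp hi with rfl | hi
      · exact h0
      · exact ih l hl i hi
    exfalso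
    let m : ι → L := fun i => (l a)⁻¹ * l i
    have hma : m a = 1 := inv_mul_cancel₀ h0
    have hm : ρ (v a) + ∑ i ∈ s, m i • ρ (v i) = 0 := by
      have := congrArg ((l a)⁻¹ • ·) hl
      simpa [smul_add, smul_smul, Finset.smul_sum, h0, m] using this
    have key : ∀ f : A →ₗ[k] k, ∀ i ∈ s,
        TensorProduct.rid k L (LinearMap.lTensor L f (ρ (m i))) =
          TensorProduct.rid k L (LinearMap.lTensor L f (m i ⊗ₜ 1)) := by
      intro f
      obtain ⟨E, hE⟩ := exists_linearMap_smul_coaction ρ hco f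
      have h1 := congrArg E hm
      have h2 : E (ρ (v a)) = f 1 • ρ (v a) := by
        have := hE 1 (v a)
        rw [one_smul] at this
        rw [this, map_one, Algebra.TensorProduct.one_def]
        simp
      rw [map_add, map_sum, map_zero, h2] at h1
      simp only [hE] at h1
      have h3 : f 1 • ρ (v a) + ∑ i ∈ s,
          (TensorProduct.rid k L (LinearMap.lTensor L f (m i ⊗ₜ 1))) • ρ (v i) = 0 := by
        have := congrArg (f 1 • ·) hm
        simpa [smul_add, Finset.smul_sum, smul_assoc] using this
      have h4 : ∑ i ∈ s, (TensorProduct.rid k L (LinearMap.lTensor L f (ρ (m i))) -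
          TensorProduct.rid k L (LinearMap.lTensor L f (m i ⊗ₜ 1))) • ρ (v i) = 0 := by
        simp only [sub_smul, Finset.sum_sub_distrib]
        rw [sub_eq_zero]
        exact add_left_cancel (h1.trans h3.symm)
      intro i hi
      exact sub_eq_zero.mp (ih _ h4 i hi)
    have hmem : ∀ i ∈ insert a s, m i ∈ coinvariants ρ := by
      intro i hi
      rcases Finset.mem_insert.mp hi with rfl | hi
      · rw [hma]; exact one_mem _
      rw [mem_coinvariants]
      let b := Module.Free.chooseBasis k A
      have hb : ∀ (y : L ⊗[k] A) j, TensorProduct.equivFinsuppOfBasisRight b y j =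
          TensorProduct.rid k L (LinearMap.lTensor L (b.coord j) y) := by
        intro y j
        induction y with
        | zero => simp
        | add x y hx hy => simp only [map_add, Finsupp.add_apply, hx, hy]
        | tmul x a => simp
      apply (TensorProduct.equivFinsuppOfBasisRight b).injective
      ext j
      rw [hb, hb, key _ i hi]
    have hrel : ∑ i ∈ insert a s, m i * v i = 0 := by
      have := congrArg (fun y => TensorProduct.rid k L (LinearMap.lTensor L Coalgebra.counit y)) hm
      have hs : ∀ (x : L) (y : L ⊗[k] A), TensorProduct.rid k L
          (LinearMap.lTensor L (Coalgebra.counit (R := k)) (x • y)) =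
          x * TensorProduct.rid k L (LinearMap.lTensor L Coalgebra.counit y) := by
        intro x y
        induction y with
        | zero => simp
        | add c d hx hy => simp only [map_add, smul_add, mul_add, hx, hy]
        | tmul c d => simp [TensorProduct.smul_tmul']
      simp only [map_add, map_sum, hs, hcu, map_zero] at this
      rw [Finset.sum_insert ha, hma, one_mul, this]
    rw [linearIndependent_iff'] at hv
    have := hv (insert a s) (fun i => if h : i ∈ insert a s then ⟨m i, hmem i h⟩ else 0) (by
      rw [← hrel]
      refine Finset.sum_congr rfl fun i hi => ?_
      rw [dif_pos hi]; rfl) a (Finset.mem_insert_self _ _)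
    rw [dif_pos (Finset.mem_insert_self _ _)] at this
    have h5 : m a = 0 := congrArg Subtype.val this
    exact one_ne_zero (hma.symm.trans h5)

theorem exists_basis_coaction [FiniteDimensional k A] {L : Type} [Field L] [Algebra k L]
    (ρ : L →ₐ[k] L ⊗[k] A)
    (hco : ∀ b, Algebra.TensorProduct.map ρ (AlgHom.id k A) (ρ b) =
      (TensorProduct.assoc k L A A).symm (LinearMap.lTensor L Coalgebra.comul (ρ b)))
    (hcu : ∀ b, TensorProduct.rid k L (LinearMap.lTensor L Coalgebra.counit (ρ b)) = b)
    (hspan : Submodule.span L (Set.range ρ) = ⊤) :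
    ∃ (ι : Type) (_ : Finite ι) (c : Module.Basis ι (coinvariants ρ) L)
      (d : Module.Basis ι L (L ⊗[k] A)), ∀ i, d i = ρ (c i) := by
  let c := Module.Free.chooseBasis (coinvariants ρ) L
  have hli := linearIndependent_coaction ρ hco hcu c c.linearIndependent
  have hfin : Finite (Module.Free.ChooseBasisIndex (coinvariants ρ) L) := hli.finite
  have hsp : ⊤ ≤ Submodule.span L (Set.range fun i => ρ (c i)) := by
    rw [← hspan, Submodule.span_le]
    rintro _ ⟨l, rfl⟩
    have hl := c.mem_span l
    induction hl using Submodule.span_induction with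
    | zero => simp
    | add x y _ _ hx hy => rw [map_add]; exact add_mem hx hy
    | smul a x _ hx =>
      have : ρ (a • x) = (a : L) • ρ x := by
        rw [IntermediateField.smul_def, smul_eq_mul, map_mul, mem_coinvariants.mp a.2,
          Algebra.smul_def]
        rfl
      rw [this]
      exact Submodule.smul_mem _ _ hx
    | mem x hx =>
      obtain ⟨i, rfl⟩ := hx
      exact Submodule.subset_span ⟨i, rfl⟩
  exact ⟨_, hfin, c, Module.Basis.mk hli hsp, fun i => by simp⟩

theorem bijective_productMap_of_basis {K L ι : Type} [Field K] [Field L] [Algebra k K]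
    [Algebra k L] [Algebra K L] [IsScalarTower k K L] (ρ : L →ₐ[K] L ⊗[k] A)
    (c : Module.Basis ι K L) (d : Module.Basis ι L (L ⊗[k] A)) (hd : ∀ i, d i = ρ (c i)) :
    Function.Bijective (Algebra.TensorProduct.productMap
      (Algebra.TensorProduct.includeLeft : L →ₐ[K] L ⊗[k] A) ρ) := by
  let e := (Algebra.TensorProduct.basis L c).equiv d (Equiv.refl ι)
  have h2 : ∀ y : L, e (1 ⊗ₜ[K] y) = ρ y := by
    intro y
    have hy := c.mem_span y
    induction hy using Submodule.span_induction with
    | zero => simp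
    | add x y _ _ hx hy => simp only [map_add, tmul_add, hx, hy]
    | smul a x _ hx =>
      have : (1 : L) ⊗ₜ[K] (a • x) = (algebraMap K L a) • (1 ⊗ₜ x) := by
        rw [← TensorProduct.smul_tmul, TensorProduct.smul_tmul', smul_eq_mul, mul_one,
          Algebra.algebraMap_eq_smul_one]
      rw [this, map_smul, hx, map_smul, algebraMap_smul]
    | mem x hx =>
      obtain ⟨i, rfl⟩ := hx
      have := (Algebra.TensorProduct.basis L c).equiv_apply i d (Equiv.refl ι)
      rw [Algebra.TensorProduct.basis_apply] at this
      rw [← hd]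
      exact this
  convert e.bijective using 1
  ext y
  induction y with
  | zero => simp
  | add x y hx hy => simp only [map_add, hx, hy]
  | tmul x y =>
    rw [Algebra.TensorProduct.productMap_apply_tmul]
    have h1 : x ⊗ₜ[K] y = x • ((1 : L) ⊗ₜ[K] y) := by simp [TensorProduct.smul_tmul']
    rw [h1, map_smul, h2, Algebra.smul_def]
    rfl

theorem exists_torsor [FiniteDimensional k A] {L : Type} [Field L] [Algebra k L]
    (ρ : L →ₐ[k] L ⊗[k] A)
    (hco : ∀ b, Algebra.TensorProduct.map ρ (AlgHom.id k A) (ρ b) =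
      (TensorProduct.assoc k L A A).symm (LinearMap.lTensor L Coalgebra.comul (ρ b)))
    (hcu : ∀ b, TensorProduct.rid k L (LinearMap.lTensor L Coalgebra.counit (ρ b)) = b)
    (hspan : Submodule.span L (Set.range ρ) = ⊤) :
    Nonempty (GTorsor k A (coinvariants ρ) L) := by
  obtain ⟨ι, hι, c, d, hd⟩ := exists_basis_coaction ρ hco hcu hspan
  let ρ' : L →ₐ[coinvariants ρ] L ⊗[k] A :=
    { ρ with commutes' := fun x => mem_coinvariants.mp x.2 }
  refine ⟨⟨ρ', LinearMap.ext hcu, LinearMap.ext fun b => ?_, inferInstance,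
    Module.Finite.of_basis c, ?_⟩⟩
  · exact hco b
  · exact bijective_productMap_of_basis ρ' c d hd

theorem isEmpty_algHom_coinvariants [FiniteDimensional k A] (hA : 1 < Module.finrank k A)
    {L : Type} [Field L] [Algebra k L]
    (ρ : L →ₐ[k] L ⊗[k] A) (hspan : Submodule.span L (Set.range ρ) = ⊤) :
    IsEmpty (L →ₐ[coinvariants ρ] coinvariants ρ) := by
  refine ⟨fun f => ?_⟩
  have hf : ∀ x : L, x ∈ coinvariants ρ := by
    intro x
    have : f (f x : L) = f x := f.commutes (f x)
    rw [← f.injective this]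
    exact (f x).2
  have hle : (⊤ : Submodule L (L ⊗[k] A)) ≤ Submodule.span L {1} := by
    rw [← hspan, Submodule.span_le]
    rintro _ ⟨x, rfl⟩
    refine Submodule.mem_span_singleton.mpr ⟨x, ?_⟩
    rw [mem_coinvariants.mp (hf x), Algebra.TensorProduct.one_def, TensorProduct.smul_tmul',
      smul_eq_mul, mul_one]
  have h1 := Submodule.finrank_mono hle
  rw [finrank_top, Module.finrank_baseChange] at h1
  have h2 := finrank_span_le_card (R := L) ({1} : Set (L ⊗[k] A))
  simp at h2
  omega


section
variable {ι : Type} (F : Type) [Field F] [Algebra k F] (b : Module.Basis ι k A)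

/-- The linear map from `A` to polynomials sending the basis `b` to the variables. -/
noncomputable def genericVector : A →ₗ[k] MvPolynomial ι F := b.constr k MvPolynomial.X

/-- The coaction of `A` on polynomials induced by its comultiplication through
`genericVector`. -/
noncomputable def polyCoaction : MvPolynomial ι F →ₐ[F] MvPolynomial ι F ⊗[k] A :=
  MvPolynomial.aeval fun i =>
    LinearMap.rTensor A (genericVector F b) (Coalgebra.comul (R := k) (b i))

theorem polyCoaction_genericVector (a : A) : polyCoaction F b (genericVector F b a) =
    LinearMap.rTensor A (genericVector F b) (Coalgebra.comul (R := k) a) := by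
  have : (polyCoaction F b).toLinearMap.restrictScalars k ∘ₗ genericVector F b =
      LinearMap.rTensor A (genericVector F b) ∘ₗ Coalgebra.comul (R := k) := by
    refine b.ext fun i => ?_
    simp [genericVector, polyCoaction]
  exact LinearMap.congr_fun this a

theorem polyCoaction_coassoc (x : MvPolynomial ι F) :
    Algebra.TensorProduct.map (polyCoaction F b) (AlgHom.id k A) (polyCoaction F b x) =
      (TensorProduct.assoc k _ A A).symm
        (LinearMap.lTensor _ Coalgebra.comul (polyCoaction F b x)) := by
  have h : (Algebra.TensorProduct.map (polyCoaction F b) (AlgHom.id k A)).comp (polyCoaction F b) =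
      ((Algebra.TensorProduct.assoc k k F (MvPolynomial ι F) A A).symm.toAlgHom.comp
        (Algebra.TensorProduct.map (AlgHom.id F _) (Bialgebra.comulAlgHom k A))).comp
          (polyCoaction F b) := by
    refine MvPolynomial.algHom_ext fun i => ?_
    have hX : (MvPolynomial.X i : MvPolynomial ι F) = genericVector F b (b i) := by
      simp [genericVector]
    rw [hX, AlgHom.comp_apply, AlgHom.comp_apply, polyCoaction_genericVector]
    have h1 : ∀ t : A ⊗[k] A, Algebra.TensorProduct.map (polyCoaction F b) (AlgHom.id k A)
        (LinearMap.rTensor A (genericVector F b) t) =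
        LinearMap.rTensor A (LinearMap.rTensor A (genericVector F b))
          (LinearMap.rTensor A (Coalgebra.comul (R := k)) t) := by
      intro t
      induction t with
      | zero => simp
      | add x y hx hy => simp only [map_add, hx, hy]
      | tmul c d => simp [polyCoaction_genericVector]
    have h2 : ∀ t : A ⊗[k] A,
        ((Algebra.TensorProduct.assoc k k F (MvPolynomial ι F) A A).symm.toAlgHom.comp
        (Algebra.TensorProduct.map (AlgHom.id F _) (Bialgebra.comulAlgHom k A)))
        (LinearMap.rTensor A (genericVector F b) t) =
        LinearMap.rTensor A (LinearMap.rTensor A (genericVector F b))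
          ((TensorProduct.assoc k A A A).symm
            (LinearMap.lTensor A (Coalgebra.comul (R := k)) t)) := by
      intro t
      induction t with
      | zero => simp
      | add x y hx hy => simp only [map_add, hx, hy]
      | tmul c d =>
        simp only [LinearMap.rTensor_tmul, LinearMap.lTensor_tmul, AlgHom.comp_apply,
          Algebra.TensorProduct.map_tmul, AlgHom.id_apply, Bialgebra.comulAlgHom_apply]
        generalize (Coalgebra.comul (R := k) d) = u
        induction u with
        | zero => simp
        | add x y hx hy => simp only [map_add, tmul_add, hx, hy]
        | tmul c d => simp
    rw [h1, h2, Coalgebra.coassoc_symm_apply]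
  have h3 := DFunLike.congr_fun h x
  rw [AlgHom.comp_apply, AlgHom.comp_apply] at h3
  rw [h3]
  generalize polyCoaction F b x = y
  induction y with
  | zero => simp
  | add x y hx hy => simp only [map_add, hx, hy]
  | tmul c d =>
    simp only [LinearMap.lTensor_tmul, AlgHom.comp_apply,
      Algebra.TensorProduct.map_tmul, AlgHom.id_apply, Bialgebra.comulAlgHom_apply]
    generalize (Coalgebra.comul (R := k) d) = u
    induction u with
    | zero => simp
    | add x y hx hy => simp only [map_add, tmul_add, hx, hy]
    | tmul c d => simp

theorem polyCoaction_counit (x : MvPolynomial ι F) :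
    TensorProduct.rid k _ (LinearMap.lTensor _ Coalgebra.counit (polyCoaction F b x)) = x := by
  have h : ((Algebra.TensorProduct.rid k F (MvPolynomial ι F)).toAlgHom.comp
      (Algebra.TensorProduct.map (AlgHom.id F _) (Bialgebra.counitAlgHom k A))).comp
          (polyCoaction F b) = AlgHom.id F _ := by
    refine MvPolynomial.algHom_ext fun i => ?_
    have hX : (MvPolynomial.X i : MvPolynomial ι F) = genericVector F b (b i) := by
      simp [genericVector]
    have h2 : ∀ t : A ⊗[k] A, ((Algebra.TensorProduct.rid k F (MvPolynomial ι F)).toAlgHom.comp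
        (Algebra.TensorProduct.map (AlgHom.id F _) (Bialgebra.counitAlgHom k A)))
        (LinearMap.rTensor A (genericVector F b) t) =
        genericVector F b (TensorProduct.rid k A
          (LinearMap.lTensor A (Coalgebra.counit (R := k)) t)) := by
      intro t
      induction t with
      | zero => simp
      | add x y hx hy => simp only [map_add, hx, hy]
      | tmul c d => simp
    rw [hX, AlgHom.comp_apply, polyCoaction_genericVector, h2, Coalgebra.lTensor_counit_comul]
    simp
  have h3 := DFunLike.congr_fun h x
  rw [AlgHom.comp_apply, AlgHom.id_apply] at h3
  conv_rhs => rw [← h3]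
  generalize polyCoaction F b x = y
  induction y with
  | zero => simp
  | add x y hx hy => simp only [map_add, hx, hy]
  | tmul c d => simp

theorem det_polyCoaction_ne_zero [Fintype ι] [DecidableEq ι] :
    Matrix.det (Matrix.of fun i j : ι => Algebra.TensorProduct.basis (MvPolynomial ι F) b |>.repr
      (polyCoaction F b (MvPolynomial.X j)) i) ≠ 0 := by
  intro h0
  let e : MvPolynomial ι F →ₐ[F] F :=
    MvPolynomial.aeval fun i => algebraMap k F (Coalgebra.counit (R := k) (b i))
  have he : ∀ a, e (genericVector F b a) = algebraMap k F (Coalgebra.counit (R := k) a) := by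
    intro a
    have : e.toLinearMap.restrictScalars k ∘ₗ genericVector F b =
        Algebra.linearMap k F ∘ₗ Coalgebra.counit (R := k) := by
      refine b.ext fun i => ?_
      simp [genericVector, e]
    exact LinearMap.congr_fun this a
  have h1 : ∀ (t : A ⊗[k] A) (i : ι), e ((Algebra.TensorProduct.basis (MvPolynomial ι F) b).repr
      (LinearMap.rTensor A (genericVector F b) t) i) =
      algebraMap k F (b.repr (TensorProduct.lid k A
        (LinearMap.rTensor A (Coalgebra.counit (R := k)) t)) i) := by
    intro t i
    induction t with
    | zero => simp
    | add x y hx hy => simp only [map_add, Finsupp.add_apply, hx, hy]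
    | tmul c d =>
      have hek : ∀ r : k, e (algebraMap k _ r) = algebraMap k F r :=
        (e.restrictScalars k).commutes
      simp only [LinearMap.rTensor_tmul, Algebra.TensorProduct.basis_repr_tmul, Finsupp.smul_apply,
        Finsupp.mapRange_apply, smul_eq_mul, map_mul, he, hek, TensorProduct.lid_tmul, map_smul]
  have h2 := congrArg e h0
  rw [map_zero, AlgHom.map_det] at h2
  have h3 : e.mapMatrix (Matrix.of fun i j : ι =>
      (Algebra.TensorProduct.basis (MvPolynomial ι F) b).repr
      (polyCoaction F b (MvPolynomial.X j)) i) = 1 := by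
    ext i j
    have hX : (MvPolynomial.X j : MvPolynomial ι F) = genericVector F b (b j) := by
      simp [genericVector]
    rw [AlgHom.mapMatrix_apply, Matrix.map_apply, Matrix.of_apply, hX, polyCoaction_genericVector,
      h1, Coalgebra.rTensor_counit_comul, TensorProduct.lid_tmul, one_smul,
      Module.Basis.repr_self, Matrix.one_apply, Finsupp.single_apply]
    by_cases h : i = j
    · simp [h]
    · simp [h, Ne.symm h]
  rw [h3, Matrix.det_one] at h2
  exact one_ne_zero h2

/-- Any extension `F` of `k` embeds into a field `L` with a coaction of `A` fixing `F` such that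
`L ⊗ A` is spanned over `L` by the image of the coaction. -/
theorem exists_field_coaction [FiniteDimensional k A] :
    ∃ (L : Type) (_ : Field L) (_ : Algebra k L) (j : F →ₐ[k] L) (ρ : L →ₐ[k] L ⊗[k] A),
      (∀ b, Algebra.TensorProduct.map ρ (AlgHom.id k A) (ρ b) =
        (TensorProduct.assoc k L A A).symm (LinearMap.lTensor L Coalgebra.comul (ρ b))) ∧
      (∀ b, TensorProduct.rid k L (LinearMap.lTensor L Coalgebra.counit (ρ b)) = b) ∧
      Submodule.span L (Set.range ρ) = ⊤ ∧ ∀ x, ρ (j x) = j x ⊗ₜ 1 := by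
  classical
  let b := Module.finBasis k A
  let S := MvPolynomial (Fin (Module.finrank k A)) F
  let L := FractionRing S
  let ρS : S →ₐ[k] S ⊗[k] A := (polyCoaction F b).restrictScalars k
  let q : S →ₐ[k] L := IsScalarTower.toAlgHom k S L
  let Q : S ⊗[k] A →ₐ[k] L ⊗[k] A := Algebra.TensorProduct.map q (AlgHom.id k A)
  have hunit : ∀ y : nonZeroDivisors S, IsUnit ((Q.comp ρS) y) := by
    intro y
    have h1 := coaction_mem_nonZeroDivisors ρS (polyCoaction_coassoc F b)
      (polyCoaction_counit F b) (nonZeroDivisors.coe_ne_zero y)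
    obtain ⟨r, hr, hd⟩ := (Algebra.IsAlgebraic.isAlgebraic (R := S) (ρS y)).exists_nonzero_dvd h1
    refine isUnit_of_dvd_unit (map_dvd Q hd) ?_
    have h2 : Q (algebraMap S (S ⊗[k] A) r) = algebraMap L (L ⊗[k] A) (algebraMap S L r) := by
      change Q (r ⊗ₜ 1) = algebraMap S L r ⊗ₜ 1
      simp [Q, q]
    rw [h2]
    refine IsUnit.map _ (IsUnit.mk0 _ ?_)
    simpa using hr
  let ρ : L →ₐ[k] L ⊗[k] A := IsLocalization.liftAlgHom (M := nonZeroDivisors S) hunit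
  have hρ : ∀ s : S, ρ (algebraMap S L s) = Q (ρS s) := fun s => by
    simp [ρ]
  refine ⟨L, inferInstance, inferInstance, q.comp (IsScalarTower.toAlgHom k F S), ρ, ?_, ?_, ?_, ?_⟩
  · let α : L ⊗[k] A →ₐ[k] (L ⊗[k] A) ⊗[k] A :=
      (Algebra.TensorProduct.assoc k k k L A A).symm.toAlgHom.comp
        (Algebra.TensorProduct.map (AlgHom.id k _) (Bialgebra.comulAlgHom k A))
    have hα : ∀ t, α t = (TensorProduct.assoc k L A A).symm
        (LinearMap.lTensor L Coalgebra.comul t) := fun t => rfl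
    let Q₂ : (S ⊗[k] A) ⊗[k] A →ₐ[k] (L ⊗[k] A) ⊗[k] A :=
      Algebra.TensorProduct.map Q (AlgHom.id k A)
    have h1 : ∀ t : S ⊗[k] A, Algebra.TensorProduct.map ρ (AlgHom.id k A) (Q t) =
        Q₂ (Algebra.TensorProduct.map ρS (AlgHom.id k A) t) := by
      intro t
      induction t with
      | zero => simp
      | add x y hx hy => simp only [map_add, hx, hy]
      | tmul c d =>
        have : q c = algebraMap S L c := rfl
        simp [Q, Q₂, this, hρ]
    have h2 : ∀ t : S ⊗[k] A, (TensorProduct.assoc k L A A).symm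
        (LinearMap.lTensor L Coalgebra.comul (Q t)) =
        Q₂ ((TensorProduct.assoc k S A A).symm (LinearMap.lTensor S Coalgebra.comul t)) := by
      intro t
      induction t with
      | zero => simp
      | add x y hx hy => simp only [map_add, hx, hy]
      | tmul c d =>
        simp only [Q, Algebra.TensorProduct.map_tmul, LinearMap.lTensor_tmul, AlgHom.id_apply]
        generalize (Coalgebra.comul (R := k) d) = u
        induction u with
        | zero => simp
        | add x y hx hy => simp only [map_add, tmul_add, hx, hy]
        | tmul c d => simp [Q₂, Q]
    have h : (Algebra.TensorProduct.map ρ (AlgHom.id k A)).comp ρ = α.comp ρ := by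
      refine IsLocalization.algHom_ext (nonZeroDivisors S) (AlgHom.ext fun s => ?_)
      change Algebra.TensorProduct.map ρ (AlgHom.id k A) (ρ (algebraMap S L s)) =
        α (ρ (algebraMap S L s))
      rw [hρ, h1, hα, h2]
      exact congrArg Q₂ (polyCoaction_coassoc F b s)
    exact fun x => DFunLike.congr_fun h x
  · let α : L ⊗[k] A →ₐ[k] L :=
      (Algebra.TensorProduct.rid k k L).toAlgHom.comp
        (Algebra.TensorProduct.map (AlgHom.id k _) (Bialgebra.counitAlgHom k A))
    have hα : ∀ t, α t = TensorProduct.rid k L (LinearMap.lTensor L Coalgebra.counit t) := by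
      intro t
      induction t with
      | zero => simp
      | add x y hx hy => simp only [map_add, hx, hy]
      | tmul c d => simp [α]
    have h2 : ∀ t : S ⊗[k] A, TensorProduct.rid k L (LinearMap.lTensor L Coalgebra.counit (Q t)) =
        q (TensorProduct.rid k S (LinearMap.lTensor S Coalgebra.counit t)) := by
      intro t
      induction t with
      | zero => simp
      | add x y hx hy => simp only [map_add, hx, hy]
      | tmul c d => simp [Q]
    have h : α.comp ρ = AlgHom.id k L := by
      refine IsLocalization.algHom_ext (nonZeroDivisors S) (AlgHom.ext fun s => ?_)
      change α (ρ (algebraMap S L s)) = algebraMap S L s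
      rw [hρ, hα, h2]
      exact congrArg q (polyCoaction_counit F b s)
    intro x
    rw [← hα]
    exact DFunLike.congr_fun h x
  · let B := Algebra.TensorProduct.basis L b
    let v : Fin (Module.finrank k A) → L ⊗[k] A := fun i => ρ (algebraMap S L (MvPolynomial.X i))
    have h1 : ∀ (t : S ⊗[k] A) i, B.repr (Q t) i =
        algebraMap S L ((Algebra.TensorProduct.basis S b).repr t i) := by
      intro t i
      induction t with
      | zero => simp
      | add x y hx hy => simp only [map_add, Finsupp.add_apply, hx, hy]
      | tmul c d =>
        simp only [B, Q, Algebra.TensorProduct.map_tmul, Algebra.TensorProduct.basis_repr_tmul,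
          Finsupp.smul_apply, Finsupp.mapRange_apply, smul_eq_mul, map_mul, AlgHom.id_apply]
        rw [← IsScalarTower.algebraMap_apply k S L]
        rfl
    have h2 : IsUnit (B.det v) := by
      rw [Module.Basis.det_apply]
      have h3 : B.toMatrix v = (algebraMap S L).mapMatrix (Matrix.of fun i j =>
          (Algebra.TensorProduct.basis S b).repr (polyCoaction F b (MvPolynomial.X j)) i) := by
        ext i j
        rw [Module.Basis.toMatrix_apply, RingHom.mapMatrix_apply, Matrix.map_apply,
          Matrix.of_apply, ← h1]
        exact congrArg (fun y => B.repr y i) (hρ _)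
      rw [h3, ← RingHom.map_det, isUnit_iff_ne_zero, Ne,
        FaithfulSMul.algebraMap_eq_zero_iff]
      exact det_polyCoaction_ne_zero F b
    rw [eq_top_iff, ← (B.is_basis_iff_det.mpr h2).2]
    refine Submodule.span_mono ?_
    rintro _ ⟨i, rfl⟩
    exact ⟨_, rfl⟩
  · intro x
    change ρ (algebraMap S L (algebraMap F S x)) = algebraMap S L (algebraMap F S x) ⊗ₜ 1
    rw [hρ]
    have : ρS (algebraMap F S x) = (algebraMap F S x) ⊗ₜ 1 := (polyCoaction F b).commutes x
    rw [this]
    simp [Q, q]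
end

theorem nonempty_algHom_of_splits_minpoly {E K : Type} [Field E] [Field K]
    [Algebra k E] [Algebra k K] (K₀ : IntermediateField k K) [Algebra.IsAlgebraic k K₀]
    [Algebra K₀ E] [IsScalarTower k K₀ E] [Module.Finite K₀ E]
    {F : Type} [Field F] [IsAlgClosed F] [Algebra k F] (j : F →ₐ[k] K) :
    Nonempty (E →ₐ[K₀] K) := by
  refine IntermediateField.nonempty_algHom_of_splits fun s => ?_
  have hs : IsIntegral K₀ s := IsIntegral.of_finite K₀ s
  refine ⟨hs, ?_⟩
  have hk : IsIntegral k s := isIntegral_trans s hs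
  have hsplit : ((minpoly k s).map (algebraMap k K)).Splits := by
    rw [← j.comp_algebraMap, ← Polynomial.map_map]
    exact (IsAlgClosed.splits _).map _
  refine hsplit.of_dvd (Polynomial.map_ne_zero (minpoly.ne_zero hk)) ?_
  rw [IsScalarTower.algebraMap_eq k K₀ K, ← Polynomial.map_map]
  exact Polynomial.map_dvd _ (minpoly.dvd_map_of_isScalarTower k K₀ s)

theorem nonempty_algHom_of_isAlgClosed {K T₀ : Type} [Field K] [Algebra k K]
    (K₀ : IntermediateField k K) [Algebra.IsAlgebraic k K₀]
    [CommRing T₀] [Nontrivial T₀] [Algebra K₀ T₀] [Module.Finite K₀ T₀]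
    {F : Type} [Field F] [IsAlgClosed F] [Algebra k F] (j : F →ₐ[k] K) :
    Nonempty (T₀ →ₐ[K₀] K) := by
  obtain ⟨m, hm⟩ := Ideal.exists_maximal T₀
  let : Field (T₀ ⧸ m) := Ideal.Quotient.field m
  let : Algebra k (T₀ ⧸ m) := ((algebraMap K₀ (T₀ ⧸ m)).comp (algebraMap k K₀)).toAlgebra
  have : IsScalarTower k K₀ (T₀ ⧸ m) := IsScalarTower.of_algebraMap_eq' rfl
  obtain ⟨f⟩ := nonempty_algHom_of_splits_minpoly (E := T₀ ⧸ m) K₀ j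
  exact ⟨f.comp (Ideal.Quotient.mkₐ K₀ m)⟩
end

/-- let `G = Spec A` be a nontrivial finite group scheme over a field `k`.
Then `ed_k(G) ≥ 1`: there exist a field extension `K/k` and a `G`-torsor over `Spec K`
which does not descend to any subextension `K₀ ⊆ K` algebraic over `k` (i.e. of
transcendence degree `0`). -/
theorem stmt18 [FiniteDimensional k A] (hA : 1 < Module.finrank k A) :
    ∃ (K : Type) (_ : Field K) (_ : Algebra k K) (T : Type) (_ : CommRing T)
      (_ : Algebra k T) (_ : Algebra K T) (_ : IsScalarTower k K T)
      (tors : GTorsor k A K T),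
      ∀ K₀ : IntermediateField k K, Algebra.IsAlgebraic k K₀ →
        ¬ ∃ (T₀ : Type) (_ : CommRing T₀) (_ : Algebra k T₀) (_ : Algebra K₀ T₀)
            (_ : IsScalarTower k K₀ T₀) (tors₀ : GTorsor k A K₀ T₀)
            (e : (K ⊗[K₀] T₀) ≃ₐ[K] T),
            -- the isomorphism `e` matches the base-changed coaction of `tors₀` with `ρ`
            tors.ρ.toLinearMap ∘ₗ e.toLinearMap =
              (TensorProduct.AlgebraTensorModule.map e.toLinearMap (LinearMap.id : A →ₗ[k] A)) ∘ₗ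
                (TensorProduct.AlgebraTensorModule.assoc k K₀ K K T₀ A).symm.toLinearMap ∘ₗ
                  LinearMap.baseChange K tors₀.ρ.toLinearMap := by
  obtain ⟨L, _, _, j, ρ, hco, hcu, hspan, hj⟩ :=
    exists_field_coaction (k := k) (A := A) (AlgebraicClosure k)
  obtain ⟨tors⟩ := exists_torsor ρ hco hcu hspan
  refine ⟨coinvariants ρ, inferInstance, inferInstance, L, inferInstance, inferInstance,
    inferInstance, inferInstance, tors, ?_⟩
  rintro K₀ hK₀ ⟨T₀, _, _, _, _, tors₀, e, -⟩
  have := tors₀.nontrivial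
  have := tors₀.finite
  let j' : AlgebraicClosure k →ₐ[k] coinvariants ρ :=
    j.codRestrict (coinvariants ρ).toSubalgebra fun x => mem_coinvariants.mpr (hj x)
  obtain ⟨f⟩ := nonempty_algHom_of_isAlgClosed (T₀ := T₀) K₀ j'
  let g : coinvariants ρ ⊗[K₀] T₀ →ₐ[coinvariants ρ] coinvariants ρ :=
    Algebra.TensorProduct.lift (AlgHom.id _ _) f fun _ _ => Commute.all _ _
  exact (isEmpty_algHom_coinvariants hA ρ hspan).false (g.comp e.symm.toAlgHom)
end
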